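/- arXiv:2110.12282 — 6 statements merged into one kernel-verified Lean document; each statement's English description precedes it below -/
import Mathlib

section
/- Let ρ be a real-valued functional on the integrable random variables of a probability space satisfying: (monotonicity) X ≤ Y a.s. implies ρ(X) ≥ ρ(Y); (subadditivity) ρ(X+Y) ≤ ρ(X)+ρ(Y); (positive homogeneity) ρ(λX) = λρ(X) for all λ ≥ 0; (translativity) ρ(X+α) = ρ(X) − α for all real α; and (strict expectation boundedness) ρ(X) > E[−X] whenever X is not a.s. constant. Then the functional δ(X) := ρ(X − E[X]) satisfies: δ(X+α) = δ(X) for all real α; δ(0) = 0; δ(λX) = λδ(X) for λ ≥ 0; δ(X+Y) ≤ δ(X)+δ(Y); δ(X) > 0 whenever X is not a.s. constant; and δ(X) ≤ E[X] − essInf X for all X (trivially if essInf X = −∞). -/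
open MeasureTheory

/-- (Rockafellar et al., direction 1) If `ρ` is a coherent risk measure (monotone,
subadditive, positively homogeneous, translative) on the integrable random variables
of a probability space which is strictly expectation bounded, then
`δ(X) := ρ(X − E[X])` is a deviation measure (translation invariant, normalized,
positively homogeneous, subadditive, strictly positive on nonconstant random
variables) which is lower range dominated. -/
theorem coherent_to_deviation {Ω : Type*} [MeasurableSpace Ω] (μ : Measure Ω)
    [IsProbabilityMeasure μ] (ρ : (Ω → ℝ) → ℝ)
    (h_mono : ∀ X Y : Ω → ℝ, Integrable X μ → Integrable Y μ →
      X ≤ᵐ[μ] Y → ρ Y ≤ ρ X)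
    (h_subadd : ∀ X Y : Ω → ℝ, Integrable X μ → Integrable Y μ →
      ρ (X + Y) ≤ ρ X + ρ Y)
    (h_poshom : ∀ X : Ω → ℝ, Integrable X μ → ∀ c : ℝ, 0 ≤ c →
      ρ (fun ω => c * X ω) = c * ρ X)
    (h_transl : ∀ X : Ω → ℝ, Integrable X μ → ∀ α : ℝ,
      ρ (fun ω => X ω + α) = ρ X - α)
    (h_seb : ∀ X : Ω → ℝ, Integrable X μ → (¬ ∃ c : ℝ, X =ᵐ[μ] fun _ => c) →
      ∫ ω, (-X ω) ∂μ < ρ X) :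
    letI δ : (Ω → ℝ) → ℝ := fun X => ρ (fun ω => X ω - ∫ x, X x ∂μ)
    -- translation invariance
    (∀ X : Ω → ℝ, Integrable X μ → ∀ α : ℝ, δ (fun ω => X ω + α) = δ X) ∧
    -- normalization
    δ (fun _ => 0) = 0 ∧
    -- positive homogeneity
    (∀ X : Ω → ℝ, Integrable X μ → ∀ c : ℝ, 0 ≤ c →
      δ (fun ω => c * X ω) = c * δ X) ∧
    -- subadditivity
    (∀ X Y : Ω → ℝ, Integrable X μ → Integrable Y μ → δ (X + Y) ≤ δ X + δ Y) ∧
    -- strict positivity on nonconstant random variables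
    (∀ X : Ω → ℝ, Integrable X μ → (¬ ∃ c : ℝ, X =ᵐ[μ] fun _ => c) → 0 < δ X) ∧
    -- lower range dominance (in the extended reals, trivially if essInf = −∞)
    (∀ X : Ω → ℝ, Integrable X μ →
      ((δ X : ℝ) : EReal) ≤ ((∫ x, X x ∂μ : ℝ) : EReal)
        - essInf (fun ω => (X ω : EReal)) μ) := by
  have h_zero : ρ (fun _ => 0) = 0 := by
    simpa using h_poshom (fun _ => 0) (integrable_const 0) 0 le_rfl
  have h_center (X : Ω → ℝ) (hX : Integrable X μ) :
      ρ (fun ω => X ω - ∫ x, X x ∂μ) = ρ X + ∫ x, X x ∂μ := by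
    simpa [sub_eq_add_neg] using h_transl X hX (-∫ x, X x ∂μ)
  refine ⟨fun X hX α => ?_, by simpa using h_zero, fun X hX c hc => ?_, fun X Y hX hY => ?_,
    fun X hX hne => ?_, fun X hX => ?_⟩ <;> beta_reduce
  · have hint : ∫ x, (X x + α) ∂μ = ∫ x, X x ∂μ + α := by
      simp [integral_add hX (integrable_const α)]
    simp [hint]
  · rw [h_center _ (hX.const_mul c), h_center X hX, h_poshom X hX c hc, integral_const_mul]
    ring
  · rw [h_center _ (hX.add hY), h_center X hX, h_center Y hY, integral_add' hX hY]
    linarith [h_subadd X Y hX hY]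
  · have h := h_seb X hX hne
    rw [integral_neg] at h
    rw [h_center X hX]
    linarith
  · rw [h_center X hX]
    have hle : ∀ᵐ ω ∂μ, essInf (fun ω => (X ω : EReal)) μ ≤ X ω := ae_essInf_le
    generalize essInf (fun ω => (X ω : EReal)) μ = e at hle ⊢
    induction e with
    | bot => simp
    | top =>
      obtain ⟨ω, hω⟩ := hle.exists
      exact absurd (top_le_iff.mp hω) (EReal.coe_ne_top _)
    | coe m =>
      have hm : ρ X ≤ ρ (fun _ => m) :=
        h_mono _ _ (integrable_const m) hX (hle.mono fun ω hω => EReal.coe_le_coe_iff.mp hω)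
      have hconst : ρ (fun _ => m) = -m := by
        simpa [h_zero] using h_transl (fun _ => 0) (integrable_const 0) m
      rw [← EReal.coe_sub, EReal.coe_le_coe_iff]
      linarith
end

section
/- Let δ be a real-valued functional on the integrable random variables of a probability space satisfying: δ(X+α) = δ(X) for all real α; δ(0) = 0; δ(λX) = λδ(X) for λ ≥ 0; δ(X+Y) ≤ δ(X)+δ(Y); δ(X) > 0 whenever X is not a.s. constant; and δ(X) ≤ E[X] − essInf X for all X (trivially if essInf X = −∞). Then the functional ρ(X) := E[−X] + δ(X) satisfies: X ≤ Y a.s. implies ρ(X) ≥ ρ(Y); ρ(X+Y) ≤ ρ(X)+ρ(Y); ρ(λX) = λρ(X) for λ ≥ 0; ρ(X+α) = ρ(X) − α for all real α; and ρ(X) > E[−X] whenever X is not a.s. constant. -/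
open MeasureTheory

/-- (Rockafellar et al., direction 2) If `δ` is a deviation measure (translation
invariant, normalized, positively homogeneous, subadditive, strictly positive on
nonconstant random variables) on the integrable random variables of a probability
space which is lower range dominated, then `ρ(X) := E[−X] + δ(X)` is a coherent
risk measure (monotone, subadditive, positively homogeneous, translative) which is
strictly expectation bounded. -/
theorem deviation_to_coherent {Ω : Type*} [MeasurableSpace Ω] (μ : Measure Ω)
    [IsProbabilityMeasure μ] (δ : (Ω → ℝ) → ℝ)
    (h_transl : ∀ X : Ω → ℝ, Integrable X μ → ∀ α : ℝ,
      δ (fun ω => X ω + α) = δ X)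
    (h_norm : δ (fun _ => 0) = 0)
    (h_poshom : ∀ X : Ω → ℝ, Integrable X μ → ∀ c : ℝ, 0 ≤ c →
      δ (fun ω => c * X ω) = c * δ X)
    (h_subadd : ∀ X Y : Ω → ℝ, Integrable X μ → Integrable Y μ →
      δ (X + Y) ≤ δ X + δ Y)
    (h_strictpos : ∀ X : Ω → ℝ, Integrable X μ →
      (¬ ∃ c : ℝ, X =ᵐ[μ] fun _ => c) → 0 < δ X)
    (h_lrd : ∀ X : Ω → ℝ, Integrable X μ →
      ((δ X : ℝ) : EReal) ≤ ((∫ x, X x ∂μ : ℝ) : EReal)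
        - essInf (fun ω => (X ω : EReal)) μ) :
    letI ρ : (Ω → ℝ) → ℝ := fun X => (∫ ω, (-X ω) ∂μ) + δ X
    -- monotonicity
    (∀ X Y : Ω → ℝ, Integrable X μ → Integrable Y μ → X ≤ᵐ[μ] Y → ρ Y ≤ ρ X) ∧
    -- subadditivity
    (∀ X Y : Ω → ℝ, Integrable X μ → Integrable Y μ → ρ (X + Y) ≤ ρ X + ρ Y) ∧
    -- positive homogeneity
    (∀ X : Ω → ℝ, Integrable X μ → ∀ c : ℝ, 0 ≤ c →
      ρ (fun ω => c * X ω) = c * ρ X) ∧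
    -- translativity
    (∀ X : Ω → ℝ, Integrable X μ → ∀ α : ℝ, ρ (fun ω => X ω + α) = ρ X - α) ∧
    -- strict expectation boundedness
    (∀ X : Ω → ℝ, Integrable X μ → (¬ ∃ c : ℝ, X =ᵐ[μ] fun _ => c) →
      ∫ ω, (-X ω) ∂μ < ρ X) := by
  refine ⟨fun X Y hX hY hXY => ?_, fun X Y hX hY => ?_, fun X hX c hc => ?_, fun X hX α => ?_,
    fun X hX hconst => ?_⟩
  · have h_nonneg : (0 : EReal) ≤ essInf (fun ω => ((Y - X) ω : EReal)) μ := by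
      refine le_essInf_of_ae_le _ ?_
      filter_upwards [hXY] with ω hω
      exact EReal.coe_nonneg.2 (sub_nonneg.2 hω)
    have h_le : δ (Y - X) ≤ ∫ ω, (Y - X) ω ∂μ := by
      refine EReal.coe_le_coe_iff.1 ((h_lrd _ (hY.sub hX)).trans ?_)
      simpa using EReal.sub_le_sub le_rfl h_nonneg
    have h_split := h_subadd X (Y - X) hX (hY.sub hX)
    rw [add_sub_cancel] at h_split
    rw [integral_sub' hY hX] at h_le
    simp only [integral_neg]
    linarith
  · have h_sum := h_subadd X Y hX hY
    simp only [integral_neg, integral_add' hX hY]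
    linarith
  · simp only [integral_neg, integral_const_mul, h_poshom X hX c hc]
    ring
  · simp only [integral_neg, integral_add hX (integrable_const α), h_transl X hX α,
      integral_const, probReal_univ, one_smul]
    ring
  · exact lt_add_of_pos_right _ (h_strictpos X hX hconst)
end

section
/- Let Y₁, …, Yₙ be integrable real random variables on a probability space. The following are equivalent: (i) MAD(∑_{i=1}^n xᵢYᵢ) = ∑_{i=1}^n xᵢ·MAD(Yᵢ) for every x ∈ ℝⁿ with nonnegative coordinates; (ii) the same equality holds for every x in the standard simplex Δ^{n−1}; (iii) MAD(∑_{i∈I} Yᵢ) = ∑_{i∈I} MAD(Yᵢ) for every nonempty subset I ⊆ {1,…,n}; (iv) (Yᵢ − E[Yᵢ])(Yⱼ − E[Yⱼ]) ≥ 0 almost surely for every i ≠ j. -/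
open MeasureTheory

/-- If the terms of a finite family of reals have pairwise nonnegative products, the triangle
inequality is an equality for its combinations with nonnegative weights. -/
theorem abs_sum_mul_eq_sum_mul_abs {ι : Type*} (s : Finset ι) {x z : ι → ℝ}
    (hx : ∀ i, 0 ≤ x i) (hz : ∀ i j, i ≠ j → 0 ≤ z i * z j) :
    |∑ i ∈ s, x i * z i| = ∑ i ∈ s, x i * |z i| := by
  by_cases h : ∃ k, z k < 0
  · obtain ⟨k, hk⟩ := h
    have hneg : ∀ j, z j ≤ 0 := fun j => by
      rcases eq_or_ne k j with rfl | hkj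
      · exact hk.le
      · exact nonpos_of_mul_nonneg_right (hz k j hkj) hk
    rw [abs_of_nonpos (Finset.sum_nonpos fun i _ =>
      mul_nonpos_of_nonneg_of_nonpos (hx i) (hneg i)), ← Finset.sum_neg_distrib]
    exact Finset.sum_congr rfl fun i _ => by rw [abs_of_nonpos (hneg i), mul_neg]
  · push Not at h
    rw [abs_of_nonneg (Finset.sum_nonneg fun i _ => mul_nonneg (hx i) (h i))]
    exact Finset.sum_congr rfl fun i _ => by rw [abs_of_nonneg (h i)]

/-- Centering commutes with finite linear combinations of integrable functions. -/
theorem sum_mul_sub_integral_sum_mul {Ω ι : Type*} [MeasurableSpace Ω] {μ : Measure Ω}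
    {Y : ι → Ω → ℝ} (hY : ∀ i, Integrable (Y i) μ) (s : Finset ι) (x : ι → ℝ) (ω : Ω) :
    (∑ i ∈ s, x i * Y i ω) - ∫ w, (∑ i ∈ s, x i * Y i w) ∂μ
      = ∑ i ∈ s, x i * (Y i ω - ∫ w, Y i w ∂μ) := by
  rw [integral_finsetSum _ fun i _ => (hY i).const_mul (x i)]
  simp only [integral_const_mul, mul_sub, Finset.sum_sub_distrib]

/-- Equality in the triangle inequality for the `L¹` norm forces the product to be nonnegative
almost everywhere. -/
theorem ae_nonneg_mul_of_integral_abs_add_eq {Ω : Type*} [MeasurableSpace Ω] {μ : Measure Ω}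
    {f g : Ω → ℝ} (hf : Integrable f μ) (hg : Integrable g μ)
    (h : ∫ ω, |f ω + g ω| ∂μ = ∫ ω, |f ω| ∂μ + ∫ ω, |g ω| ∂μ) :
    ∀ᵐ ω ∂μ, 0 ≤ f ω * g ω := by
  have hadd : Integrable (fun ω => |f ω| + |g ω|) μ := hf.abs.add hg.abs
  have habs : Integrable (fun ω => |f ω + g ω|) μ := (hf.add hg).abs
  have hzero : ∫ ω, (|f ω| + |g ω| - |f ω + g ω|) ∂μ = 0 := by
    rw [integral_sub hadd habs, integral_add hf.abs hg.abs, h, sub_self]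
  have hae := (integral_eq_zero_iff_of_nonneg
    (fun ω => sub_nonneg.2 (abs_add_le (f ω) (g ω))) (hadd.sub habs)).1 hzero
  filter_upwards [hae] with ω hω
  have heq : |f ω + g ω| = |f ω| + |g ω| := (sub_eq_zero.1 hω).symm
  rcases (abs_add_eq_add_abs_iff _ _).1 heq with h | h
  · exact mul_nonneg h.1 h.2
  · exact mul_nonneg_of_nonpos_of_nonpos h.1 h.2

/-- Additivity of the mean absolute deviation on one positive multiple of a sum of two variables
makes the product of the centered variables almost surely nonnegative. -/
theorem ae_nonneg_centered_mul_of_mad_pair {Ω ι : Type*} [MeasurableSpace Ω] [DecidableEq ι]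
    {μ : Measure Ω} [IsProbabilityMeasure μ] {Y : ι → Ω → ℝ} (hY : ∀ i, Integrable (Y i) μ)
    {i j : ι} (hij : i ≠ j) {c : ℝ} (hc : 0 < c)
    (h : ∫ ω, |(∑ k ∈ {i, j}, c * Y k ω) - ∫ w, (∑ k ∈ {i, j}, c * Y k w) ∂μ| ∂μ
      = ∑ k ∈ {i, j}, c * ∫ ω, |Y k ω - ∫ w, Y k w ∂μ| ∂μ) :
    ∀ᵐ ω ∂μ, 0 ≤ (Y i ω - ∫ x, Y i x ∂μ) * (Y j ω - ∫ x, Y j x ∂μ) := by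
  refine ae_nonneg_mul_of_integral_abs_add_eq ((hY i).sub (integrable_const _))
    ((hY j).sub (integrable_const _)) ?_
  simp only [sum_mul_sub_integral_sum_mul hY {i, j} fun _ => c] at h
  simp only [Finset.sum_pair hij, ← mul_add, abs_mul, abs_of_pos hc, integral_const_mul] at h
  exact mul_left_cancel₀ (ne_of_gt hc) h

/-- The mean absolute deviation is additive on nonnegative combinations of integrable variables
whose centered versions have pairwise almost surely nonnegative products. -/
theorem mad_sum_mul_eq_of_ae_nonneg_mul {Ω ι : Type*} [MeasurableSpace Ω] [Fintype ι]
    {μ : Measure Ω} [IsProbabilityMeasure μ] {Y : ι → Ω → ℝ} (hY : ∀ i, Integrable (Y i) μ)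
    (h : ∀ i j, i ≠ j → ∀ᵐ ω ∂μ, 0 ≤ (Y i ω - ∫ w, Y i w ∂μ) * (Y j ω - ∫ w, Y j w ∂μ))
    (x : ι → ℝ) (hx : ∀ i, 0 ≤ x i) :
    ∫ ω, |(∑ i, x i * Y i ω) - ∫ w, (∑ i, x i * Y i w) ∂μ| ∂μ
      = ∑ i, x i * ∫ ω, |Y i ω - ∫ w, Y i w ∂μ| ∂μ := by
  have hall : ∀ᵐ ω ∂μ, ∀ i j, i ≠ j →
      0 ≤ (Y i ω - ∫ w, Y i w ∂μ) * (Y j ω - ∫ w, Y j w ∂μ) := by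
    simpa only [ae_all_iff] using h
  calc ∫ ω, |(∑ i, x i * Y i ω) - ∫ w, (∑ i, x i * Y i w) ∂μ| ∂μ
      = ∫ ω, ∑ i, x i * |Y i ω - ∫ w, Y i w ∂μ| ∂μ := by
        refine integral_congr_ae ?_
        filter_upwards [hall] with ω hω
        rw [sum_mul_sub_integral_sum_mul hY, abs_sum_mul_eq_sum_mul_abs _ hx hω]
    _ = ∑ i, x i * ∫ ω, |Y i ω - ∫ w, Y i w ∂μ| ∂μ := by
        simp only [← integral_const_mul]
        exact integral_finsetSum _ fun i _ =>
          ((hY i).sub (integrable_const _)).abs.const_mul (x i)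

/-- Additivity of the mean absolute deviation on the standard simplex makes the products of
distinct centered variables almost surely nonnegative. -/
theorem ae_nonneg_centered_mul_of_mad_simplex {Ω ι : Type*} [MeasurableSpace Ω] [Fintype ι]
    {μ : Measure Ω} [IsProbabilityMeasure μ] {Y : ι → Ω → ℝ} (hY : ∀ i, Integrable (Y i) μ)
    (h : ∀ x : ι → ℝ, (∀ i, 0 ≤ x i) → (∑ i, x i) = 1 →
      ∫ ω, |(∑ i, x i * Y i ω) - ∫ w, (∑ i, x i * Y i w) ∂μ| ∂μ
        = ∑ i, x i * ∫ ω, |Y i ω - ∫ w, Y i w ∂μ| ∂μ)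
    (i j : ι) (hij : i ≠ j) :
    ∀ᵐ ω ∂μ, 0 ≤ (Y i ω - ∫ x, Y i x ∂μ) * (Y j ω - ∫ x, Y j x ∂μ) := by
  classical
  have hpair := h (fun k => if k ∈ ({i, j} : Finset ι) then 1 / 2 else 0)
    (fun k => by positivity)
    (by rw [Finset.sum_ite_mem, Finset.univ_inter, Finset.sum_pair hij]; norm_num)
  simp only [ite_mul, zero_mul, Finset.sum_ite_mem, Finset.univ_inter] at hpair
  exact ae_nonneg_centered_mul_of_mad_pair hY hij one_half_pos hpair

/-- (Multivariate additivity of MAD) For integrable real random variables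
`Y₁, …, Yₙ`, the following are equivalent:
(i) `MAD(∑ᵢ xᵢYᵢ) = ∑ᵢ xᵢ·MAD(Yᵢ)` for every `x` with nonnegative coordinates;
(ii) the same holds for every `x` in the standard simplex;
(iii) `MAD(∑_{i∈I} Yᵢ) = ∑_{i∈I} MAD(Yᵢ)` for every nonempty `I ⊆ {1,…,n}`;
(iv) `(Yᵢ − E[Yᵢ])(Yⱼ − E[Yⱼ]) ≥ 0` a.s. for every `i ≠ j`. -/
theorem mad_additivity_tfae {Ω : Type*} [MeasurableSpace Ω] (μ : Measure Ω)
    [IsProbabilityMeasure μ] (n : ℕ) (Y : Fin n → Ω → ℝ)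
    (hY : ∀ i, Integrable (Y i) μ) :
    letI Pi : Prop := ∀ x : Fin n → ℝ, (∀ i, 0 ≤ x i) →
      ∫ ω, |(∑ i, x i * Y i ω) - ∫ w, (∑ i, x i * Y i w) ∂μ| ∂μ
        = ∑ i, x i * ∫ ω, |Y i ω - ∫ w, Y i w ∂μ| ∂μ
    letI Pii : Prop := ∀ x : Fin n → ℝ, (∀ i, 0 ≤ x i) → (∑ i, x i) = 1 →
      ∫ ω, |(∑ i, x i * Y i ω) - ∫ w, (∑ i, x i * Y i w) ∂μ| ∂μ
        = ∑ i, x i * ∫ ω, |Y i ω - ∫ w, Y i w ∂μ| ∂μ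
    letI Piii : Prop := ∀ I : Finset (Fin n), I.Nonempty →
      ∫ ω, |(∑ i ∈ I, Y i ω) - ∫ w, (∑ i ∈ I, Y i w) ∂μ| ∂μ
        = ∑ i ∈ I, ∫ ω, |Y i ω - ∫ w, Y i w ∂μ| ∂μ
    letI Piv : Prop := ∀ i j : Fin n, i ≠ j →
      ∀ᵐ ω ∂μ, 0 ≤ (Y i ω - ∫ x, Y i x ∂μ) * (Y j ω - ∫ x, Y j x ∂μ)
    (Pi ↔ Pii) ∧ (Pi ↔ Piii) ∧ (Pi ↔ Piv) := by
  refine ⟨⟨fun h x hx _ => h x hx, fun h => mad_sum_mul_eq_of_ae_nonneg_mul hY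
      (ae_nonneg_centered_mul_of_mad_simplex hY h)⟩,
    ⟨fun h I _ => ?_, fun h => mad_sum_mul_eq_of_ae_nonneg_mul hY fun i j hij => ?_⟩,
    ⟨fun h => ae_nonneg_centered_mul_of_mad_simplex hY fun x hx _ => h x hx,
      mad_sum_mul_eq_of_ae_nonneg_mul hY⟩⟩
  · have hI := h (fun i => if i ∈ I then 1 else 0) fun i => by positivity
    simpa only [ite_mul, one_mul, zero_mul, Finset.sum_ite_mem, Finset.univ_inter] using hI
  · exact ae_nonneg_centered_mul_of_mad_pair hY hij one_pos
      (by simpa only [one_mul] using h {i, j} (Finset.insert_nonempty i {j}))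
end

section
/- Assume the nondegeneracy condition. Then for every λ > 0 the function x ↦ f(x) − λ∑_{i=1}^n ln xᵢ attains its infimum over the open positive orthant ℝⁿ₊₊ = {x ∈ ℝⁿ : xᵢ > 0 for all i} at exactly one point. -/
open Set

/-- The sum of the logarithms of the coordinates is strictly concave on the positive orthant. -/
lemma strictConcaveOn_sum_log {ι : Type*} [Fintype ι] :
    StrictConcaveOn ℝ {x : ι → ℝ | ∀ i, 0 < x i} fun x => ∑ i, Real.log (x i) := by
  refine ⟨fun x hx y hy a b ha hb hab i => convex_Ioi (0 : ℝ) (hx i) (hy i) ha hb hab, ?_⟩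
  intro x hx y hy hxy a b ha hb hab
  obtain ⟨j, hj⟩ := Function.ne_iff.mp hxy
  simp only [smul_eq_mul, Finset.mul_sum, ← Finset.sum_add_distrib]
  exact Finset.sum_lt_sum
    (fun i _ => strictConcaveOn_log_Ioi.concaveOn.2 (hx i) (hy i) ha.le hb.le hab)
    ⟨j, Finset.mem_univ j, strictConcaveOn_log_Ioi.2 (hx j) (hy j) hj ha hb hab⟩

/-- A continuous, positively homogeneous function which is positive on the nonzero nonnegative
vectors dominates a positive multiple of the coordinate sum on the nonnegative orthant. -/
lemma exists_pos_mul_sum_le {ι : Type*} [Fintype ι] [Nonempty ι] {f : (ι → ℝ) → ℝ}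
    (hcont : Continuous f) (hhom : ∀ r : ℝ, 0 ≤ r → ∀ x, f (r • x) = r * f x)
    (hpos : ∀ x, (∀ i, 0 ≤ x i) → x ≠ 0 → 0 < f x) :
    ∃ c > 0, ∀ x : ι → ℝ, (∀ i, 0 ≤ x i) → c * ∑ i, x i ≤ f x := by
  classical
  obtain ⟨z, hz, hmin⟩ := (isCompact_stdSimplex ℝ ι).exists_isMinOn
    ⟨_, single_mem_stdSimplex ℝ (Classical.arbitrary ι)⟩ hcont.continuousOn
  refine ⟨f z, hpos z hz.1 ?_, fun x hx => ?_⟩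
  · rintro rfl
    simpa using hz.2
  rcases (Finset.sum_nonneg fun i _ => hx i : 0 ≤ ∑ i, x i).eq_or_lt with h | h
  · have hx0 : x = 0 := funext fun i =>
      (Finset.sum_eq_zero_iff_of_nonneg fun i _ => hx i).mp h.symm i (Finset.mem_univ i)
    have h0 := hhom 0 le_rfl x
    rw [zero_smul, zero_mul] at h0
    simp [hx0, h0]
  · have hmem : (∑ i, x i)⁻¹ • x ∈ stdSimplex ℝ ι := by
      refine ⟨fun i => mul_nonneg (inv_nonneg.mpr h.le) (hx i), ?_⟩
      simp only [Pi.smul_apply, smul_eq_mul, ← Finset.mul_sum]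
      exact inv_mul_cancel₀ h.ne'
    have hle : f z ≤ f ((∑ i, x i)⁻¹ • x) := hmin hmem
    rw [hhom _ (inv_nonneg.mpr h.le), inv_mul_eq_div] at hle
    exact (le_div_iff₀ h).mp hle

/-- The function `s ↦ c * s - lam * log s` has an affine minorant of slope `c / 2`. -/
lemma half_mul_add_le_mul_sub_log {c lam s : ℝ} (hc : 0 < c) (hlam : 0 < lam) (hs : 0 < s) :
    c / 2 * s + lam * (1 + Real.log (c / (2 * lam))) ≤ c * s - lam * Real.log s := by
  have hk : 0 < c / (2 * lam) := by positivity
  have h := Real.log_le_sub_one_of_pos (mul_pos hk hs)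
  rw [Real.log_mul hk.ne' hs.ne'] at h
  have h' := mul_le_mul_of_nonneg_left h hlam.le
  have e : lam * (c / (2 * lam) * s - 1) = c / 2 * s - lam := by field_simp
  linarith

/-- A logarithmic barrier added to a continuous function with a linear lower bound attains its
minimum over the positive orthant. -/
lemma exists_isMinOn_sub_sum_log {ι : Type*} [Fintype ι] {f : (ι → ℝ) → ℝ}
    (hcont : Continuous f) {c lam : ℝ} (hc : 0 < c) (hlam : 0 < lam)
    (hlow : ∀ x : ι → ℝ, (∀ i, 0 ≤ x i) → c * ∑ i, x i ≤ f x) :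
    ∃ x ∈ {x : ι → ℝ | ∀ i, 0 < x i},
      IsMinOn (fun x => f x - lam * ∑ i, Real.log (x i)) {x | ∀ i, 0 < x i} x := by
  classical
  set g : (ι → ℝ) → ℝ := fun x => f x - lam * ∑ i, Real.log (x i) with hg
  set C := lam * (1 + Real.log (c / (2 * lam))) with hC
  set B := g 1 + Fintype.card ι * |C| with hB
  have hsub : ∀ y : ι → ℝ, (∀ i, 0 < y i) → g y ≤ g 1 → ∀ i,
      c * y i - lam * Real.log (y i) ≤ B := by
    intro y hy hgy i
    have hsum : ∑ j, (c * y j - lam * Real.log (y j)) ≤ g y := by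
      rw [Finset.sum_sub_distrib, ← Finset.mul_sum, ← Finset.mul_sum]
      exact sub_le_sub_right (hlow y fun j => (hy j).le) _
    have hterm : ∀ j, 0 ≤ c * y j - lam * Real.log (y j) + |C| := fun j => by
      have h := half_mul_add_le_mul_sub_log hc hlam (hy j)
      have : 0 < c / 2 * y j := mul_pos (by positivity) (hy j)
      linarith [neg_abs_le C]
    have hsingle := Finset.single_le_sum (fun j _ => hterm j) (Finset.mem_univ i)
    rw [Finset.sum_add_distrib, Finset.sum_const, Finset.card_univ, nsmul_eq_mul] at hsingle
    linarith [abs_nonneg C]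
  set K : Set (ι → ℝ) := Icc (fun _ => Real.exp (-B / lam)) (fun _ => 2 * (B - C) / c) with hK
  have hmem : ∀ y : ι → ℝ, (∀ i, 0 < y i) → g y ≤ g 1 → y ∈ K := by
    intro y hy hgy
    refine ⟨fun i => ?_, fun i => ?_⟩
    · have h := hsub y hy hgy i
      have : 0 < c * y i := mul_pos hc (hy i)
      rw [← Real.le_log_iff_exp_le (hy i), div_le_iff₀ hlam]
      linarith
    · have h := hsub y hy hgy i
      have h' := half_mul_add_le_mul_sub_log hc hlam (hy i)
      rw [le_div_iff₀ hc]
      linarith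
  have hKpos : ∀ y ∈ K, ∀ i, 0 < y i := fun y hy i => (Real.exp_pos _).trans_le (hy.1 i)
  have hone : (1 : ι → ℝ) ∈ K := hmem 1 (fun _ => one_pos) le_rfl
  have hgK : ContinuousOn g K := hcont.continuousOn.sub <| continuousOn_const.mul <|
    continuousOn_finsetSum _ fun i _ =>
      (continuous_apply i).continuousOn.log fun y hy => (hKpos y hy i).ne'
  obtain ⟨x, hx, hmin⟩ := isCompact_Icc.exists_isMinOn ⟨1, hone⟩ hgK
  refine ⟨x, hKpos x hx, fun y hy => ?_⟩
  rcases le_total (g y) (g 1) with h | h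
  · exact hmin (hmem y hy h)
  · exact (hmin hone : g x ≤ g 1).trans h

/-- Under the nondegeneracy condition, for every `λ > 0` the function
`x ↦ f(x) − λ∑ᵢ ln xᵢ`, where `f` is the portfolio MAD
`f(x) = (1/T)∑ₜ |⟨aₜ, x⟩|`, attains its infimum over the open positive orthant at
exactly one point. -/
theorem mad_log_barrier_unique_min (n T : ℕ) (hn : 1 ≤ n) (hT : 1 ≤ T)
    (a : Fin T → Fin n → ℝ)
    (hnd : ∀ x : Fin n → ℝ, (∀ i, 0 ≤ x i) →
      (∀ t, (∑ i, a t i * x i) = 0) → x = 0)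
    (lam : ℝ) (hlam : 0 < lam) :
    ∃! x : Fin n → ℝ, (∀ i, 0 < x i) ∧
      ∀ y : Fin n → ℝ, (∀ i, 0 < y i) →
        (1 / (T : ℝ)) * (∑ t, |∑ i, a t i * x i|) - lam * ∑ i, Real.log (x i)
          ≤ (1 / (T : ℝ)) * (∑ t, |∑ i, a t i * y i|) - lam * ∑ i, Real.log (y i) := by
  have : Nonempty (Fin n) := ⟨⟨0, hn⟩⟩
  have hT' : (0 : ℝ) < 1 / T := one_div_pos.mpr (by exact_mod_cast hT)
  set f : (Fin n → ℝ) → ℝ := fun x => (1 / (T : ℝ)) * (∑ t, |∑ i, a t i * x i|) with hf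
  have hcont : Continuous f := by fun_prop
  have hhom : ∀ r : ℝ, 0 ≤ r → ∀ x, f (r • x) = r * f x := fun r hr x => by
    simp only [hf, Pi.smul_apply, smul_eq_mul, mul_left_comm _ r, ← Finset.mul_sum, abs_mul,
      abs_of_nonneg hr]
  have hsubadd : ∀ x y, f (x + y) ≤ f x + f y := fun x y => by
    simp only [hf, Pi.add_apply, mul_add, Finset.sum_add_distrib]
    rw [← mul_add, ← Finset.sum_add_distrib]
    exact mul_le_mul_of_nonneg_left (Finset.sum_le_sum fun t _ => abs_add_le _ _) hT'.le
  have hpos : ∀ x, (∀ i, 0 ≤ x i) → x ≠ 0 → 0 < f x := fun x hx hx0 => by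
    refine mul_pos hT' ((Finset.sum_nonneg fun t _ => abs_nonneg _).lt_of_ne' fun h => hx0 ?_)
    refine hnd x hx fun t => abs_eq_zero.mp ?_
    exact (Finset.sum_eq_zero_iff_of_nonneg fun t _ => abs_nonneg _).mp h t (Finset.mem_univ t)
  have hconv : ConvexOn ℝ {x : Fin n → ℝ | ∀ i, 0 < x i} f :=
    ⟨strictConcaveOn_sum_log.1, fun x _ y _ r s hr hs _ => by
      simpa only [hhom r hr, hhom s hs, smul_eq_mul] using hsubadd (r • x) (s • y)⟩
  have hstrict : StrictConvexOn ℝ {x : Fin n → ℝ | ∀ i, 0 < x i}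
      fun x => f x - lam * ∑ i, Real.log (x i) := by
    refine ⟨hconv.1, fun x hx y hy hxy r s hr hs hrs => ?_⟩
    have h₁ := hconv.2 hx hy hr.le hs.le hrs
    have h₂ := mul_lt_mul_of_pos_left (strictConcaveOn_sum_log.2 hx hy hxy hr hs hrs) hlam
    simp only [smul_eq_mul] at h₁ h₂ ⊢
    linarith
  obtain ⟨c, hc, hlow⟩ := exists_pos_mul_sum_le hcont hhom hpos
  obtain ⟨x, hx, hmin⟩ := exists_isMinOn_sub_sum_log hcont hc hlam hlow
  exact ⟨x, ⟨hx, fun y hy => hmin hy⟩, fun y ⟨hy, hymin⟩ =>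
    hstrict.eq_of_isMinOn (fun z hz => hymin z hz) hmin hy hx⟩
end

section
/- (Existence and uniqueness of the MAD-RP portfolio) Assume the nondegeneracy condition. Then there exists exactly one point x in the standard simplex Δ^{n−1} for which there exist a subgradient s of f at x and a real number λ with xᵢ·sᵢ = λ for every i ∈ {1,…,n}; moreover, this unique x has all coordinates strictly positive. -/
open Filter Topology

section Sublinear

variable {ι : Type*} [Fintype ι] {f : (ι → ℝ) → ℝ}

/-- First-order comparison of `∏ (1 + ε bᵢ)` with `(1 + ε A) ^ n` at `ε = 0`. -/
lemma sum_le_card_mul_of_prod_le_pow {b : ι → ℝ} {A : ℝ}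
    (h : ∀ᶠ ε : ℝ in 𝓝[>] 0, ∏ i, (1 + ε * b i) ≤ (1 + ε * A) ^ Fintype.card ι) :
    ∑ i, b i ≤ Fintype.card ι * A := by
  classical
  have hlin (c : ℝ) : HasDerivAt (fun ε : ℝ => 1 + ε * c) c 0 := by
    simpa using ((hasDerivAt_id (0 : ℝ)).mul_const c).const_add 1
  have hprod : HasDerivAt (fun ε : ℝ => ∏ i, (1 + ε * b i)) (∑ i, b i) 0 := by
    simpa using HasDerivAt.fun_finsetProd (u := Finset.univ) fun i _ => hlin (b i)
  have hpow : HasDerivAt (fun ε : ℝ => (1 + ε * A) ^ Fintype.card ι)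
      (Fintype.card ι * A) 0 := by
    simpa using (hlin A).fun_pow (Fintype.card ι)
  have hslope := (hasDerivAt_iff_tendsto_slope.1 (hpow.sub hprod)).mono_left
    (nhdsWithin_mono 0 (s := Set.Ioi 0) fun ε hε => (Set.mem_Ioi.1 hε).ne')
  refine sub_nonneg.1 (ge_of_tendsto hslope ?_)
  filter_upwards [h, self_mem_nhdsWithin] with ε hε hε0
  have hε0' : (0 : ℝ) < ε := hε0
  simp only [slope_def_field, Pi.sub_apply]
  apply div_nonneg
  · simpa using hε
  · simpa using hε0'.le

/-- A maximizer of `∏ xᵢ / f(x) ^ n` over the simplex equalizes the risk contributions. -/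
lemma exists_equal_risk_subgradient [Nonempty ι] (hcont : Continuous f)
    (hadd : ∀ x y, f (x + y) ≤ f x + f y)
    (hhom : ∀ c : ℝ, 0 ≤ c → ∀ x, f (c • x) = c * f x)
    (hpos : ∀ x, 0 ≤ x → x ≠ 0 → 0 < f x) :
    ∃ x ∈ stdSimplex ℝ ι, (∀ i, 0 < x i) ∧
      ∀ y, ∑ i, f x / Fintype.card ι / x i * y i ≤ f y := by
  classical
  have hsimplex : ∀ x ∈ stdSimplex ℝ ι, 0 < f x := by
    refine fun x hx => hpos x hx.1 ?_
    rintro rfl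
    simpa using hx.2
  have hcard : (0 : ℝ) < Fintype.card ι := by exact_mod_cast Fintype.card_pos
  obtain ⟨x, hx, hmax⟩ := (isCompact_stdSimplex ℝ ι).exists_isMaxOn
    (f := fun x => (∏ i, x i) / f x ^ Fintype.card ι)
    ⟨_, single_mem_stdSimplex ℝ (Classical.arbitrary ι)⟩
    (ContinuousOn.div (by fun_prop) (by fun_prop)
      fun x hx => (pow_pos (hsimplex x hx) _).ne')
  have hfx := hsimplex x hx
  have hmax' : ∀ z : ι → ℝ, (∀ i, 0 < z i) →
      (∏ i, z i) / f z ^ Fintype.card ι ≤ (∏ i, x i) / f x ^ Fintype.card ι := by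
    intro z hz
    have hsum : 0 < ∑ i, z i := Finset.sum_pos (fun i _ => hz i) Finset.univ_nonempty
    have hmem : (∑ i, z i)⁻¹ • z ∈ stdSimplex ℝ ι := by
      refine ⟨fun i => mul_nonneg (inv_pos.2 hsum).le (hz i).le, ?_⟩
      simp only [Pi.smul_apply, smul_eq_mul, ← Finset.mul_sum]
      exact inv_mul_cancel₀ hsum.ne'
    have hle := hmax hmem
    simp only [Set.mem_ofPred_eq, hhom _ (inv_pos.2 hsum).le, Pi.smul_apply, smul_eq_mul,
      Finset.prod_mul_distrib, Finset.prod_const, Finset.card_univ, mul_pow] at hle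
    rwa [mul_div_mul_left _ _ (pow_pos (inv_pos.2 hsum) _).ne'] at hle
  have hprod : 0 < ∏ i, x i := by
    have h1 := hmax' (fun _ => 1) fun _ => one_pos
    have h2 : 0 < f (fun _ => 1) := hpos _ (fun _ => zero_le_one)
      fun h => one_ne_zero (congrFun h (Classical.arbitrary ι))
    have h3 : 0 < (∏ i, x i) / f x ^ Fintype.card ι := lt_of_lt_of_le (by
      simp only [Finset.prod_const_one]; positivity) h1
    exact (div_pos_iff_of_pos_right (pow_pos hfx _)).1 h3
  have hxpos : ∀ i, 0 < x i := fun i =>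
    (hx.1 i).lt_of_ne fun h => hprod.ne' (Finset.prod_eq_zero (Finset.mem_univ i) h.symm)
  refine ⟨x, hx, hxpos, fun y => ?_⟩
  have hfirst : ∑ i, y i / x i ≤ Fintype.card ι * (f y / f x) := by
    apply sum_le_card_mul_of_prod_le_pow
    have hnear : ∀ᶠ ε : ℝ in 𝓝[>] 0, ∀ i, 0 < x i + ε * y i := by
      refine (eventually_all.2 fun i => ?_).filter_mono nhdsWithin_le_nhds
      have hc : ContinuousAt (fun ε : ℝ => x i + ε * y i) 0 := by fun_prop
      exact hc.eventually (lt_mem_nhds (by simpa using hxpos i))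
    filter_upwards [hnear, self_mem_nhdsWithin] with ε hε hε0
    have hε0' : (0 : ℝ) < ε := hε0
    have hz : 0 < f (x + ε • y) := hpos _ (fun i => (hε i).le)
      fun h => (hε (Classical.arbitrary ι)).ne' (congrFun h _)
    have hle := hmax' (x + ε • y) hε
    rw [div_le_div_iff₀ (by positivity) (by positivity)] at hle
    have hsub : f (x + ε • y) ≤ f x + ε * f y := by
      simpa [hhom ε hε0'.le] using hadd x (ε • y)
    have hfactor : ∏ i, (1 + ε * (y i / x i)) = (∏ i, (x + ε • y) i) / ∏ i, x i := by
      rw [← Finset.prod_div_distrib]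
      refine Finset.prod_congr rfl fun i _ => ?_
      have := (hxpos i).ne'
      simp only [Pi.add_apply, Pi.smul_apply, smul_eq_mul]
      field_simp
    have hscale : 1 + ε * (f y / f x) = (f x + ε * f y) / f x := by field_simp
    rw [hfactor, hscale, div_pow, div_le_div_iff₀ hprod (by positivity)]
    calc _ ≤ _ := hle
      _ = f (x + ε • y) ^ Fintype.card ι * ∏ i, x i := mul_comm _ _
      _ ≤ _ := by gcongr
  calc ∑ i, f x / Fintype.card ι / x i * y i
      = f x / Fintype.card ι * ∑ i, y i / x i := by
        rw [Finset.mul_sum]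
        exact Finset.sum_congr rfl fun i _ => by ring
    _ ≤ f x / Fintype.card ι * (Fintype.card ι * (f y / f x)) := by gcongr
    _ = f y := by field_simp

/-- A subgradient of a positively homogeneous function supports it at the origin and is exact
at the base point. -/
lemma subgradient_of_homogeneous (hhom : ∀ c : ℝ, 0 ≤ c → ∀ x, f (c • x) = c * f x)
    {x s : ι → ℝ} (hs : ∀ y, f x + ∑ i, s i * (y i - x i) ≤ f y) :
    ∑ i, s i * x i = f x ∧ ∀ y, ∑ i, s i * y i ≤ f y := by
  have hsub (y : ι → ℝ) : ∑ i, s i * (y i - x i) = ∑ i, s i * y i - ∑ i, s i * x i := by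
    simp only [mul_sub, Finset.sum_sub_distrib]
  simp only [hsub] at hs
  have h0 := hs ((0 : ℝ) • x)
  have h2 := hs ((2 : ℝ) • x)
  have e2 : ∑ i, s i * ((2 : ℝ) • x) i = 2 * ∑ i, s i * x i := by
    rw [Finset.mul_sum]
    exact Finset.sum_congr rfl fun i _ => by simp only [Pi.smul_apply, smul_eq_mul]; ring
  rw [hhom _ le_rfl] at h0
  rw [hhom _ zero_le_two, e2] at h2
  simp only [Pi.smul_apply, smul_eq_mul, zero_mul, mul_zero, Finset.sum_const_zero] at h0
  have heq : ∑ i, s i * x i = f x := by linarith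
  exact ⟨heq, fun y => by linarith [hs y]⟩

/-- Equal risk contributions force the common value and all weights to be positive. -/
lemma pos_of_equal_risk [Nonempty ι] {x s : ι → ℝ} {lam : ℝ} (hx : ∀ i, 0 ≤ x i)
    (hfx : 0 < f x) (hsx : ∑ i, s i * x i = f x) (hlam : ∀ i, x i * s i = lam) :
    0 < lam ∧ Fintype.card ι * lam = f x ∧ ∀ i, 0 < x i := by
  have hsum : Fintype.card ι * lam = f x := by
    rw [← hsx, Finset.sum_congr rfl fun i _ => (mul_comm (s i) (x i)).trans (hlam i)]
    simp
  have hlpos : 0 < lam := pos_of_mul_pos_right (hsum ▸ hfx) (Nat.cast_nonneg _)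
  refine ⟨hlpos, hsum, fun i => (hx i).lt_of_ne fun h => hlpos.ne ?_⟩
  rw [← hlam i, ← h, zero_mul]

/-- Two points of the simplex with equal risk contributions coincide. -/
lemma equal_risk_unique [Nonempty ι]
    (hhom : ∀ c : ℝ, 0 ≤ c → ∀ x, f (c • x) = c * f x)
    (hpos : ∀ x, 0 ≤ x → x ≠ 0 → 0 < f x) {x x' s s' : ι → ℝ} {lam lam' : ℝ}
    (hx : x ∈ stdSimplex ℝ ι) (hx' : x' ∈ stdSimplex ℝ ι)
    (hs : ∀ y, f x + ∑ i, s i * (y i - x i) ≤ f y) (hlam : ∀ i, x i * s i = lam)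
    (hs' : ∀ y, f x' + ∑ i, s' i * (y i - x' i) ≤ f y) (hlam' : ∀ i, x' i * s' i = lam') :
    x' = x := by
  have hsimplex : ∀ x ∈ stdSimplex ℝ ι, 0 < f x := by
    refine fun x hx => hpos x hx.1 ?_
    rintro rfl
    simpa using hx.2
  obtain ⟨hsx, hsy⟩ := subgradient_of_homogeneous hhom hs
  obtain ⟨hsx', hsy'⟩ := subgradient_of_homogeneous hhom hs'
  obtain ⟨hl, hsum, hxp⟩ := pos_of_equal_risk hx.1 (hsimplex x hx) hsx hlam
  obtain ⟨hl', hsum', hxp'⟩ := pos_of_equal_risk hx'.1 (hsimplex x' hx') hsx' hlam'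
  have hterm (i : ι) : (lam * x' i - lam' * x i) ^ 2 / (x i * x' i)
      = lam * (s i * x' i) + lam' * (s' i * x i) - 2 * (lam * lam') := by
    have h1 := (hxp i).ne'
    have h2 := (hxp' i).ne'
    rw [eq_div_of_mul_eq h1 ((mul_comm _ _).trans (hlam i)),
      eq_div_of_mul_eq h2 ((mul_comm _ _).trans (hlam' i))]
    field_simp
    ring
  have hnonneg (i : ι) : 0 ≤ (lam * x' i - lam' * x i) ^ 2 / (x i * x' i) :=
    div_nonneg (sq_nonneg _) (mul_pos (hxp i) (hxp' i)).le
  have hle : ∑ i, (lam * x' i - lam' * x i) ^ 2 / (x i * x' i) ≤ 0 := by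
    simp only [hterm, Finset.sum_sub_distrib, Finset.sum_add_distrib, ← Finset.mul_sum,
      Finset.sum_const, Finset.card_univ, nsmul_eq_mul]
    have h1 := mul_le_mul_of_nonneg_left (hsy x') hl.le
    have h2 := mul_le_mul_of_nonneg_left (hsy' x) hl'.le
    rw [← hsum'] at h1
    rw [← hsum] at h2
    linarith
  have hzero := (Finset.sum_eq_zero_iff_of_nonneg fun i _ => hnonneg i).1
    (hle.antisymm (Finset.sum_nonneg fun i _ => hnonneg i))
  have hprop (i : ι) : lam * x' i = lam' * x i := by
    have h := hzero i (Finset.mem_univ i)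
    rw [div_eq_zero_iff, or_iff_left (mul_pos (hxp i) (hxp' i)).ne'] at h
    exact sub_eq_zero.1 (pow_eq_zero_iff two_ne_zero |>.1 h)
  have hll : lam = lam' := by
    have h := Finset.sum_congr (rfl : (Finset.univ : Finset ι) = _) fun i _ => hprop i
    rwa [← Finset.mul_sum, ← Finset.mul_sum, hx.2, hx'.2, mul_one, mul_one] at h
  funext i
  have h := hprop i
  rw [← hll] at h
  exact mul_left_cancel₀ hl.ne' h

end Sublinear

/-- (Existence and uniqueness of the MAD-RP portfolio) Under the nondegeneracy
condition, there exists exactly one point `x` of the standard simplex admitting a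
subgradient `s` of `f` at `x` and a real `λ` with `xᵢ·sᵢ = λ` for all `i`;
moreover this unique `x` has all coordinates strictly positive. Here `f` is the
portfolio MAD `f(x) = (1/T)∑ₜ |⟨aₜ, x⟩|`. -/
theorem madRP_exists_unique (n T : ℕ) (hn : 1 ≤ n) (hT : 1 ≤ T)
    (a : Fin T → Fin n → ℝ)
    (hnd : ∀ x : Fin n → ℝ, (∀ i, 0 ≤ x i) →
      (∀ t, (∑ i, a t i * x i) = 0) → x = 0) :
    ∃ x : Fin n → ℝ,
      (((∀ i, 0 ≤ x i) ∧ (∑ i, x i) = 1) ∧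
        (∃ (s : Fin n → ℝ) (lam : ℝ),
          (∀ y : Fin n → ℝ,
            (1 / (T : ℝ)) * (∑ t, |∑ i, a t i * x i|)
                + (∑ i, s i * (y i - x i))
              ≤ (1 / (T : ℝ)) * (∑ t, |∑ i, a t i * y i|)) ∧
          (∀ i, x i * s i = lam)) ∧
        (∀ i, 0 < x i)) ∧
      (∀ x' : Fin n → ℝ,
        ((∀ i, 0 ≤ x' i) ∧ (∑ i, x' i) = 1) →
        (∃ (s : Fin n → ℝ) (lam : ℝ),
          (∀ y : Fin n → ℝ,
            (1 / (T : ℝ)) * (∑ t, |∑ i, a t i * x' i|)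
                + (∑ i, s i * (y i - x' i))
              ≤ (1 / (T : ℝ)) * (∑ t, |∑ i, a t i * y i|)) ∧
          (∀ i, x' i * s i = lam)) →
        x' = x) := by
  have hne : Nonempty (Fin n) := ⟨⟨0, hn⟩⟩
  have hT' : (0 : ℝ) < 1 / T := by positivity
  set f : (Fin n → ℝ) → ℝ := fun x => (1 / (T : ℝ)) * ∑ t, |∑ i, a t i * x i| with hf
  have hcont : Continuous f := by fun_prop
  have hadd : ∀ x y, f (x + y) ≤ f x + f y := by
    intro x y
    simp only [hf, ← mul_add, ← Finset.sum_add_distrib, Pi.add_apply]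
    gcongr with t
    simpa only [mul_add, Finset.sum_add_distrib] using abs_add_le _ _
  have hhom : ∀ c : ℝ, 0 ≤ c → ∀ x, f (c • x) = c * f x := by
    intro c hc x
    simp only [hf, Pi.smul_apply, smul_eq_mul, mul_left_comm _ c, ← Finset.mul_sum, abs_mul,
      abs_of_nonneg hc]
  have hpos : ∀ x, 0 ≤ x → x ≠ 0 → 0 < f x := by
    intro x hx hx0
    refine mul_pos hT' ((Finset.sum_nonneg fun t _ => abs_nonneg _).lt_of_ne' fun h => hx0 ?_)
    rw [Finset.sum_eq_zero_iff_of_nonneg fun t _ => abs_nonneg _] at h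
    exact hnd x hx fun t => abs_eq_zero.1 (h t (Finset.mem_univ t))
  obtain ⟨x, hx, hxpos, hsupp⟩ := exists_equal_risk_subgradient hcont hadd hhom hpos
  have hcontrib (i : Fin n) : x i * (f x / Fintype.card (Fin n) / x i)
      = f x / Fintype.card (Fin n) := mul_div_cancel₀ _ (hxpos i).ne'
  have hexact : ∑ i, f x / Fintype.card (Fin n) / x i * x i = f x := by
    rw [Finset.sum_congr rfl fun i _ => (mul_comm _ _).trans (hcontrib i)]
    simp only [Finset.sum_const, Finset.card_univ, nsmul_eq_mul]
    exact mul_div_cancel₀ _ (by simpa using hne.elim fun i => i.pos.ne')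
  have hsub (y : Fin n → ℝ) :
      f x + ∑ i, f x / Fintype.card (Fin n) / x i * (y i - x i) ≤ f y := by
    simp only [mul_sub, Finset.sum_sub_distrib, hexact]
    linarith [hsupp y]
  refine ⟨x, ⟨hx, ⟨_, _, hsub, hcontrib⟩, hxpos⟩, ?_⟩
  rintro x' hx' ⟨s', lam', hs', hlam'⟩
  exact equal_risk_unique hhom hpos hx hx' hsub hcontrib hs' hlam'
end

section
/- (Closed-form solution for the long-only MAD-RP portfolio) Assume the nondegeneracy condition and additionally that a_{it}·a_{jt} ≥ 0 for every scenario t and every pair of assets i ≠ j. Let mᵢ := (1/T)∑_{t=1}^T |a_{it}| denote the MAD of asset i (each mᵢ > 0 under nondegeneracy). Then the point x* ∈ Δ^{n−1} defined by x*ᵢ = mᵢ⁻¹ / ∑_{j=1}^n mⱼ⁻¹ is the unique point x of Δ^{n−1} for which there exist a subgradient s of f at x and a real number λ with xᵢ·sᵢ = λ for every i. -/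
/-- A vector whose coordinates have pairwise nonnegative products has a common sign. -/
lemma exists_common_sign {ι : Type*} (v : ι → ℝ)
    (h : ∀ i j, i ≠ j → 0 ≤ v i * v j) :
    ∃ σ : ℝ, |σ| ≤ 1 ∧ ∀ i, σ * v i = |v i| := by
  by_cases hp : ∃ i, 0 < v i
  · obtain ⟨i, hi⟩ := hp
    refine ⟨1, by simp, fun j => ?_⟩
    have hj : 0 ≤ v j := by
      rcases eq_or_ne i j with rfl | hij
      · exact hi.le
      · exact nonneg_of_mul_nonneg_right (h i j hij) hi
    rw [abs_of_nonneg hj, one_mul]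
  · push Not at hp
    refine ⟨-1, by simp, fun j => ?_⟩
    rw [abs_of_nonpos (hp j), neg_one_mul]

/-- The mean absolute deviation of the portfolio `x`. -/
noncomputable def portfolioMAD {n T : ℕ} (a : Fin T → Fin n → ℝ) (x : Fin n → ℝ) : ℝ :=
  (1 / (T : ℝ)) * ∑ t, |∑ i, a t i * x i|

/-- The mean absolute deviation of the single asset `i`. -/
noncomputable def assetMAD {n T : ℕ} (a : Fin T → Fin n → ℝ) (i : Fin n) : ℝ :=
  (1 / (T : ℝ)) * ∑ t, |a t i|

lemma sum_assetMAD_mul {n T : ℕ} (a : Fin T → Fin n → ℝ) (x : Fin n → ℝ) :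
    ∑ i, assetMAD a i * x i = (1 / (T : ℝ)) * ∑ t, ∑ i, |a t i| * x i := by
  rw [Finset.sum_comm, Finset.mul_sum]
  exact Finset.sum_congr rfl fun i _ => by rw [assetMAD, mul_assoc, Finset.sum_mul]

lemma sum_assetMAD_mul_le_portfolioMAD {n T : ℕ} (a : Fin T → Fin n → ℝ)
    (hadd : ∀ (t : Fin T) (i j : Fin n), i ≠ j → 0 ≤ a t i * a t j) (x : Fin n → ℝ) :
    ∑ i, assetMAD a i * x i ≤ portfolioMAD a x := by
  rw [sum_assetMAD_mul, portfolioMAD]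
  gcongr with t
  obtain ⟨σ, hσ, h⟩ := exists_common_sign (a t) (hadd t)
  calc ∑ i, |a t i| * x i = σ * ∑ i, a t i * x i := by
        rw [Finset.mul_sum]
        exact Finset.sum_congr rfl fun i _ => by rw [← h i, mul_assoc]
    _ ≤ |σ| * |∑ i, a t i * x i| := (le_abs_self _).trans (abs_mul _ _).le
    _ ≤ |∑ i, a t i * x i| := mul_le_of_le_one_left (abs_nonneg _) hσ

/-- On the nonnegative orthant the portfolio MAD is linear. -/
lemma portfolioMAD_eq_of_nonneg {n T : ℕ} (a : Fin T → Fin n → ℝ)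
    (hadd : ∀ (t : Fin T) (i j : Fin n), i ≠ j → 0 ≤ a t i * a t j) {x : Fin n → ℝ}
    (hx : ∀ i, 0 ≤ x i) : portfolioMAD a x = ∑ i, assetMAD a i * x i := by
  refine le_antisymm ?_ (sum_assetMAD_mul_le_portfolioMAD a hadd x)
  rw [sum_assetMAD_mul, portfolioMAD]
  gcongr with t
  refine (Finset.abs_sum_le_sum_abs _ _).trans_eq (Finset.sum_congr rfl fun i _ => ?_)
  rw [abs_mul, abs_of_nonneg (hx i)]

lemma assetMAD_pos {n T : ℕ} (hT : 1 ≤ T) (a : Fin T → Fin n → ℝ)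
    (hnd : ∀ x : Fin n → ℝ, (∀ i, 0 ≤ x i) → (∀ t, (∑ i, a t i * x i) = 0) → x = 0)
    (i : Fin n) : 0 < assetMAD a i := by
  have hex : ∃ t, a t i ≠ 0 := by
    by_contra! h
    have hzero := hnd (Pi.single i 1)
      (fun j => (Pi.single_nonneg.2 zero_le_one : (0 : Fin n → ℝ) ≤ Pi.single i 1) j)
      (fun t => by simp [Pi.single_apply, h t])
    simpa using congrFun hzero i
  obtain ⟨t, ht⟩ := hex
  have hTpos : (0 : ℝ) < T := by exact_mod_cast hT
  exact mul_pos (by positivity)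
    (Finset.sum_pos' (fun _ _ => abs_nonneg _) ⟨t, Finset.mem_univ t, abs_pos.2 ht⟩)

/-- At a nonnegative portfolio every subgradient yields the same risk contributions. -/
lemma assetMAD_mul_eq_of_subgradient {n T : ℕ} (a : Fin T → Fin n → ℝ)
    (hadd : ∀ (t : Fin T) (i j : Fin n), i ≠ j → 0 ≤ a t i * a t j)
    {x s : Fin n → ℝ} (hx : ∀ i, 0 ≤ x i)
    (hs : ∀ y : Fin n → ℝ, portfolioMAD a x + ∑ i, s i * (y i - x i) ≤ portfolioMAD a y)
    (i : Fin n) : x i * assetMAD a i = x i * s i := by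
  have key : ∀ c : ℝ, 0 ≤ x i + c → s i * c ≤ assetMAD a i * c := by
    intro c hc
    have hy : ∀ j, 0 ≤ (x + Pi.single i c : Fin n → ℝ) j := by
      intro j
      rcases eq_or_ne j i with rfl | hj
      · simpa using hc
      · simpa [hj] using hx j
    have h := hs (x + Pi.single i c)
    rw [portfolioMAD_eq_of_nonneg a hadd hx, portfolioMAD_eq_of_nonneg a hadd hy] at h
    simpa [mul_add, Finset.sum_add_distrib, Pi.single_apply] using h
  have h₁ := key (x i) (by linarith [hx i])
  have h₂ := key (-x i) (by simp)
  linarith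

/-- (Closed-form solution for the long-only MAD-RP portfolio) Under the
nondegeneracy condition and assuming `a_{it}·a_{jt} ≥ 0` for all `t` and `i ≠ j`,
with `mᵢ = (1/T)∑ₜ |a_{it}|` the MAD of asset `i`, the point `x*` of the standard
simplex with `x*ᵢ = mᵢ⁻¹ / ∑ⱼ mⱼ⁻¹` is the unique point `x` of the simplex
admitting a subgradient `s` of `f` at `x` and a real `λ` with `xᵢ·sᵢ = λ` for
every `i`. Here `f(x) = (1/T)∑ₜ |⟨aₜ, x⟩|`. -/
theorem madRP_closed_form (n T : ℕ) (hn : 1 ≤ n) (hT : 1 ≤ T)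
    (a : Fin T → Fin n → ℝ)
    (hnd : ∀ x : Fin n → ℝ, (∀ i, 0 ≤ x i) →
      (∀ t, (∑ i, a t i * x i) = 0) → x = 0)
    (hadd : ∀ (t : Fin T) (i j : Fin n), i ≠ j → 0 ≤ a t i * a t j) :
    ∀ x : Fin n → ℝ,
      (((∀ i, 0 ≤ x i) ∧ (∑ i, x i) = 1) ∧
        ∃ (s : Fin n → ℝ) (lam : ℝ),
          (∀ y : Fin n → ℝ,
            (1 / (T : ℝ)) * (∑ t, |∑ i, a t i * x i|)
                + (∑ i, s i * (y i - x i))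
              ≤ (1 / (T : ℝ)) * (∑ t, |∑ i, a t i * y i|)) ∧
          (∀ i, x i * s i = lam))
      ↔ x = fun i =>
          ((1 / (T : ℝ)) * ∑ t, |a t i|)⁻¹
            / ∑ j, ((1 / (T : ℝ)) * ∑ t, |a t j|)⁻¹ := by
  intro x
  have hm := assetMAD_pos hT a hnd
  have hne : (Finset.univ : Finset (Fin n)).Nonempty := ⟨⟨0, hn⟩, Finset.mem_univ _⟩
  have hS : 0 < ∑ j, (assetMAD a j)⁻¹ := Finset.sum_pos (fun j _ => inv_pos.2 (hm j)) hne
  change _ ↔ x = fun i => (assetMAD a i)⁻¹ / ∑ j, (assetMAD a j)⁻¹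
  constructor
  · rintro ⟨⟨hx, hsum⟩, s, lam, hs, hlam⟩
    have hxlam : ∀ i, x i = lam * (assetMAD a i)⁻¹ := fun i => by
      rw [← hlam i, ← assetMAD_mul_eq_of_subgradient a hadd hx hs i,
        mul_inv_cancel_right₀ (hm i).ne']
    have hlamS : lam * ∑ j, (assetMAD a j)⁻¹ = 1 := by
      rw [Finset.mul_sum, ← hsum]
      exact Finset.sum_congr rfl fun i _ => (hxlam i).symm
    funext i
    rw [hxlam i, eq_div_iff hS.ne', mul_right_comm, hlamS, one_mul]
  · intro hxeq
    have hx : ∀ i, 0 ≤ x i := fun i => by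
      rw [hxeq]
      exact div_nonneg (inv_nonneg.2 (hm i).le) hS.le
    refine ⟨⟨hx, ?_⟩, assetMAD a, (∑ j, (assetMAD a j)⁻¹)⁻¹, fun y => ?_, fun i => ?_⟩
    · rw [hxeq, ← Finset.sum_div, div_self hS.ne']
    · change portfolioMAD a x + _ ≤ portfolioMAD a y
      rw [portfolioMAD_eq_of_nonneg a hadd hx]
      simpa [mul_sub] using sum_assetMAD_mul_le_portfolioMAD a hadd y
    · have := (hm i).ne'
      rw [hxeq]
      field_simp
end
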